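/- Let R be a finitely generated torsion ℂ[∂]-module. Then in ℒie₁ R = R[t^{±1}]/∂̃₁R[t^{±1}] (with ∂̃₁ = ∂ + ∂ₜ), every element r ⊗ tᵐ with m ≥ 0 is zero, and the quotient map restricts to a ℂ-linear isomorphism ℒie₁ R ≅ R·t^{−1}; that is, R[t^{±1}] = Rt^{−1} ⊕ ∂̃₁R[t^{±1}]. -/

import Mathlib

noncomputable section

/-- The operator `∂̃₁ = ∂ + ∂ₜ` on `R[t, t⁻¹]` (modelled as `ℤ →₀ R`) for a
`ℂ[∂]`-module `R`: `r t^s ↦ (∂ r) t^s + s r t^{s-1}`. -/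
def Dtilde1 (R : Type*) [AddCommGroup R] [Module ℂ R] [Module (Polynomial ℂ) R]
    [IsScalarTower ℂ (Polynomial ℂ) R] :
    (ℤ →₀ R) →ₗ[ℂ] (ℤ →₀ R) :=
  Finsupp.lsum ℂ (fun s : ℤ =>
    Finsupp.lsingle s ∘ₗ
        ((LinearMap.lsmul (Polynomial ℂ) R Polynomial.X).restrictScalars ℂ) +
      ((s : ℂ)) • Finsupp.lsingle (s - 1))

section

variable {R : Type*} [AddCommGroup R] [Module ℂ R] [Module (Polynomial ℂ) R]
  [IsScalarTower ℂ (Polynomial ℂ) R]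

theorem Dtilde1_single (s : ℤ) (r : R) :
    Dtilde1 R (Finsupp.single s r) =
      Finsupp.single s ((Polynomial.X : Polynomial ℂ) • r) +
        (s : ℂ) • Finsupp.single (s - 1) r := by
  simp [Dtilde1]

theorem Dtilde1_apply (x : ℤ →₀ R) (n : ℤ) :
    Dtilde1 R x n = (Polynomial.X : Polynomial ℂ) • x n + ((n : ℂ) + 1) • x (n + 1) := by
  induction x using Finsupp.induction_linear with
  | zero => simp
  | add f g hf hg =>
    rw [map_add, Finsupp.add_apply, hf, hg]
    simp only [Finsupp.add_apply, smul_add]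
    abel
  | single s r =>
    rw [Dtilde1_single]
    simp only [Finsupp.add_apply, Finsupp.smul_apply, Finsupp.single_apply]
    by_cases h : s = n + 1
    · subst h
      simp
    · have h' : s - 1 ≠ n := by lia
      by_cases h2 : s = n <;> simp [h, h', h2]

theorem mkQ_single_X_smul (s : ℤ) (r : R) :
    (LinearMap.range (Dtilde1 R)).mkQ
        (Finsupp.single s ((Polynomial.X : Polynomial ℂ) • r)) =
      (-(s : ℂ)) • (LinearMap.range (Dtilde1 R)).mkQ (Finsupp.single (s - 1) r) := by
  rw [← map_smul, ← sub_eq_zero, ← map_sub, neg_smul, sub_neg_eq_add, ← Dtilde1_single]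
  simp

theorem mkQ_single_X_pow_smul (i n : ℕ) (r : R) :
    (LinearMap.range (Dtilde1 R)).mkQ
        (Finsupp.single (n : ℤ) ((Polynomial.X ^ i : Polynomial ℂ) • r)) =
      ((-1) ^ i * (n.descFactorial i : ℂ)) •
        (LinearMap.range (Dtilde1 R)).mkQ (Finsupp.single ((n : ℤ) - i) r) := by
  induction i generalizing r with
  | zero => simp
  | succ i ih =>
    rw [pow_succ, mul_smul, ih, mkQ_single_X_smul, smul_smul, Nat.descFactorial_succ]
    have hs : (n : ℤ) - i - 1 = (n : ℤ) - (i + 1 : ℕ) := by push_cast; ring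
    rw [hs]
    congr 1
    rcases le_or_gt i n with h | h
    · push_cast [Nat.cast_sub h]
      ring
    · simp [Nat.descFactorial_of_lt h]

theorem mkQ_single_polynomial_smul (f : Polynomial ℂ) (n : ℕ) (r : R) :
    (LinearMap.range (Dtilde1 R)).mkQ (Finsupp.single (n : ℤ) (f • r)) =
      ∑ i ∈ f.support, (f.coeff i * ((-1) ^ i * (n.descFactorial i : ℂ))) •
        (LinearMap.range (Dtilde1 R)).mkQ (Finsupp.single ((n : ℤ) - i) r) := by
  conv_lhs => rw [f.as_sum_support_C_mul_X_pow]
  rw [Finset.sum_smul, Finsupp.single_finsetSum, map_sum]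
  refine Finset.sum_congr rfl fun i _ => ?_
  rw [← Polynomial.smul_eq_C_mul, smul_assoc, ← Finsupp.smul_single, map_smul,
    mkQ_single_X_pow_smul, smul_smul]

theorem single_natCast_mem_range_Dtilde1 {f : Polynomial ℂ} (hf : f ≠ 0) {r : R}
    (hr : f • r = 0) (m : ℕ) :
    Finsupp.single (m : ℤ) r ∈ LinearMap.range (Dtilde1 R) := by
  induction m using Nat.strong_induction_on with
  | _ m ih =>
    set k := f.natTrailingDegree
    have h := mkQ_single_polynomial_smul f (m + k) r
    rw [hr, Finsupp.single_zero, map_zero,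
      Finset.sum_eq_single_of_mem k (Polynomial.natTrailingDegree_mem_support_of_nonzero hf)] at h
    · have hc : f.coeff k * ((-1) ^ k * ((m + k).descFactorial k : ℂ)) ≠ 0 := by
        refine mul_ne_zero (Polynomial.trailingCoeff_nonzero_iff_nonzero.2 hf)
          (mul_ne_zero (by simp) ?_)
        simp [Nat.descFactorial_eq_zero_iff_lt]
      have h0 := (smul_eq_zero.1 h.symm).resolve_left hc
      rwa [Nat.cast_add, add_sub_cancel_right, Submodule.mkQ_apply,
        Submodule.Quotient.mk_eq_zero] at h0
    · intro i hi hik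
      have hki : k ≤ i := Polynomial.natTrailingDegree_le_of_mem_supp i hi
      rcases lt_or_ge (m + k) i with hlt | hle
      · simp [Nat.descFactorial_of_lt hlt]
      · have hmem := ih (m + k - i) (by lia)
        rw [Nat.cast_sub hle] at hmem
        rw [Submodule.mkQ_apply, (Submodule.Quotient.mk_eq_zero _).2 hmem, smul_zero]

theorem single_neg_mem_sup_range_Dtilde1 (n : ℕ) (r : R) :
    Finsupp.single (-1 - (n : ℤ)) r ∈
      Finsupp.supported R ℂ ({-1} : Set ℤ) ⊔ LinearMap.range (Dtilde1 R) := by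
  induction n generalizing r with
  | zero =>
    exact Submodule.mem_sup_left (Finsupp.single_mem_supported ℂ r (by simp))
  | succ n ih =>
    have h := Dtilde1_single (-1 - (n : ℤ)) r
    have hc : (((-1 - (n : ℤ) : ℤ)) : ℂ) ≠ 0 := by
      rw [Int.cast_ne_zero]
      lia
    rw [show -1 - (n : ℤ) - 1 = -1 - ((n + 1 : ℕ) : ℤ) by push_cast; ring] at h
    rw [← Submodule.smul_mem_iff _ hc, ← sub_eq_of_eq_add' h]
    exact sub_mem (Submodule.mem_sup_right ⟨_, rfl⟩) (ih _)

theorem disjoint_supported_range_Dtilde1 :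
    Disjoint (Finsupp.supported R ℂ ({-1} : Set ℤ)) (LinearMap.range (Dtilde1 R)) := by
  rw [Submodule.disjoint_def]
  rintro _ hy ⟨x, rfl⟩
  have hsupp : ∀ n : ℤ, n ≠ -1 → Dtilde1 R x n = 0 := fun n hn =>
    (Finsupp.mem_supported' ℂ _).1 hy n (by simpa using hn)
  obtain ⟨b, hb⟩ := x.support.bddBelow
  have hlow : ∀ n < b, x n = 0 := fun n hn => by
    by_contra h
    exact absurd (hb (Finset.mem_coe.2 (Finsupp.mem_support_iff.2 h))) (not_le.2 hn)
  have hneg : ∀ j : ℕ, b - 1 + j ≤ -1 → x (b - 1 + j) = 0 := by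
    intro j
    induction j with
    | zero => exact fun _ => hlow _ (by simp)
    | succ j ih =>
      intro hj
      push_cast at hj ⊢
      have h := hsupp (b - 1 + j) (by lia)
      rw [Dtilde1_apply, ih (by lia), smul_zero, zero_add] at h
      rw [← add_assoc]
      refine (smul_eq_zero.1 h).resolve_left ?_
      have : b - 1 + j + 1 ≠ 0 := by lia
      exact_mod_cast this
  have hx : x (-1) = 0 := by
    rcases lt_or_ge (-1) b with h | h
    · exact hlow _ h
    · have := hneg (-b).toNat (by lia)
      rwa [show b - 1 + ((-b).toNat : ℤ) = -1 by lia] at this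
  ext n
  by_cases hn : n = -1
  · subst hn
    simp [Dtilde1_apply, hx]
  · exact hsupp n hn

end

/-- for a finitely generated torsion `ℂ[∂]`-module `R`, every element
`r ⊗ t^s` with `s ≥ 0` vanishes in `ℒie₁ R = R[t^{±1}]/∂̃₁ R[t^{±1}]`, and
`R[t^{±1}] = R·t^{−1} ⊕ ∂̃₁ R[t^{±1}]`, so that `ℒie₁ R ≅ R t^{−1}`. -/
theorem stmt13 (R : Type*) [AddCommGroup R] [Module ℂ R] [Module (Polynomial ℂ) R]
    [IsScalarTower ℂ (Polynomial ℂ) R] [Module.Finite (Polynomial ℂ) R]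
    (htor : ∀ r : R, ∃ f : Polynomial ℂ, f ≠ 0 ∧ f • r = 0) :
    (∀ (r : R) (s : ℤ), 0 ≤ s →
        Finsupp.single s r ∈ LinearMap.range (Dtilde1 R)) ∧
    IsCompl (Finsupp.supported R ℂ ({-1} : Set ℤ))
      (LinearMap.range (Dtilde1 R)) := by
  have hnonneg : ∀ (r : R) (s : ℤ), 0 ≤ s →
      Finsupp.single s r ∈ LinearMap.range (Dtilde1 R) := by
    intro r s hs
    obtain ⟨f, hf, hr⟩ := htor r
    lift s to ℕ using hs
    exact single_natCast_mem_range_Dtilde1 hf hr s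
  refine ⟨hnonneg, disjoint_supported_range_Dtilde1, ?_⟩
  rw [codisjoint_iff, eq_top_iff]
  intro x _
  induction x using Finsupp.induction_linear with
  | zero => exact zero_mem _
  | add f g hf hg => exact add_mem (hf trivial) (hg trivial)
  | single s r =>
    rcases le_or_gt 0 s with hs | hs
    · exact Submodule.mem_sup_right (hnonneg r s hs)
    · have h := single_neg_mem_sup_range_Dtilde1 (-1 - s).toNat r
      rwa [show -1 - (((-1 - s).toNat : ℕ) : ℤ) = s by lia] at h
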